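/- Let R be an associative (not necessarily unital) ring, k ≥ 2, and y₁,…,y_k ∈ R. Then there exists a finite (possibly empty) list of pairs of index sequences ((j₁,…,j_i),(l₁,…,l_{k−i})), each with 0 ≤ i ≤ k−2 and with the concatenation (j₁,…,j_i,l₁,…,l_{k−i}) a permutation of (1,…,k), such that y₁y₂y₃⋯y_k = y₂y₁y₃⋯y_k + Σ over the list of y_{j₁}⋯y_{j_i}·[y_{l₁},…,y_{l_{k−i}}], where each summand carries coefficient 1. -/

import Mathlib

/-- Left-associated product of a list in a (possibly nonunital) ring,
with junk value `0` on the empty list. -/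
def listProd {R : Type*} [NonUnitalRing R] : List R → R
  | [] => 0
  | a :: l => l.foldl (· * ·) a

/-- Left-normed iterated commutator `[a, b₁, …, b_m]`, where `[x, y] = xy - yx`. -/
def lcomm {R : Type*} [NonUnitalRing R] : R → List R → R
  | a, [] => a
  | a, b :: l => lcomm (a * b - b * a) l

/-- Left-normed commutator of the elements of a list (junk value `0` on `[]`). -/
def lcommList {R : Type*} [NonUnitalRing R] : List R → R
  | [] => 0
  | a :: l => lcomm a l

theorem foldl_mul_add {R : Type*} [NonUnitalRing R] (l : List R) (a b : R) :
    l.foldl (· * ·) (a + b) = l.foldl (· * ·) a + l.foldl (· * ·) b := by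
  induction l generalizing a b with
  | nil => rfl
  | cons c l ih => simp only [List.foldl_cons, add_mul, ih]

theorem foldl_mul_mul_left {R : Type*} [NonUnitalRing R] (l : List R) (a b : R) :
    l.foldl (· * ·) (a * b) = a * l.foldl (· * ·) b := by
  induction l generalizing b with
  | nil => rfl
  | cons c l ih => simp only [List.foldl_cons, mul_assoc, ih]

theorem lcomm_append_singleton {R : Type*} [NonUnitalRing R] (l : List R) (a b : R) :
    lcomm a (l ++ [b]) = lcomm a l * b - b * lcomm a l := by
  induction l generalizing a with
  | nil => rfl
  | cons c l ih => exact ih _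

theorem lcommList_append_singleton {R : Type*} [NonUnitalRing R] {l : List R} (hl : l ≠ [])
    (b : R) : lcommList (l ++ [b]) = lcommList l * b - b * lcommList l := by
  cases l with
  | nil => exact absurd rfl hl
  | cons a l => exact lcomm_append_singleton l a b

/-- A long commutator multiplied on the right by a product of generators is a sum of long
commutators multiplied on the left by products of generators. -/
theorem exists_foldl_lcommList_eq_sum {R ι : Type*} [NonUnitalRing R] (y : ι → R)
    (r l : List ι) (hl : l ≠ []) :
    ∃ L : List (List ι × List ι),
      (∀ pr ∈ L, l.length ≤ pr.2.length ∧ (pr.1 ++ pr.2).Perm (l ++ r)) ∧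
      (r.map y).foldl (· * ·) (lcommList (l.map y)) =
        (L.map fun pr => (pr.1.map y).foldr (· * ·) (lcommList (pr.2.map y))).sum := by
  induction r generalizing l with
  | nil => exact ⟨[([], l)], by simp, by simp⟩
  | cons b r ih =>
    obtain ⟨L₁, h₁, e₁⟩ := ih l hl
    obtain ⟨L₂, h₂, e₂⟩ := ih (l ++ [b]) (by simp)
    refine ⟨L₁.map (fun pr => (b :: pr.1, pr.2)) ++ L₂, ?_, ?_⟩
    · intro pr hpr
      rcases List.mem_append.1 hpr with h | h
      · obtain ⟨q, hq, rfl⟩ := List.mem_map.1 h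
        exact ⟨(h₁ q hq).1, ((h₁ q hq).2.cons b).trans List.perm_middle.symm⟩
      · obtain ⟨hlen, hperm⟩ := h₂ pr h
        refine ⟨?_, by simpa using hperm⟩
        rw [List.length_append] at hlen
        omega
    · have hc : lcommList (l.map y) * y b =
          y b * lcommList (l.map y) + lcommList ((l ++ [b]).map y) := by
        rw [List.map_append, List.map_singleton,
          lcommList_append_singleton (by simpa using hl)]
        abel
      rw [List.map_cons, List.foldl_cons, hc, foldl_mul_add, foldl_mul_mul_left, e₁, e₂,
        List.map_append, List.sum_append, ← List.sum_map_mul_left, List.map_map]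
      rfl

theorem stmt8 {R : Type*} [NonUnitalRing R] (k : ℕ) (hk : 2 ≤ k) (y : Fin k → R) :
    ∃ L : List (List (Fin k) × List (Fin k)),
      (∀ pr ∈ L,
        pr.1.length ≤ k - 2 ∧ 2 ≤ pr.2.length ∧
          (pr.1 ++ pr.2).Perm (List.finRange k)) ∧
      listProd ((List.finRange k).map y) =
        listProd ((List.finRange k).map
            (y ∘ Equiv.swap (⟨0, by omega⟩ : Fin k) (⟨1, by omega⟩ : Fin k))) +
          (L.map fun pr =>
            (pr.1.map y).foldr (· * ·) (lcommList (pr.2.map y))).sum := by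
  obtain ⟨n, rfl⟩ := Nat.exists_eq_add_of_le' hk
  set r : List (Fin (n + 2)) := (List.finRange n).map fun i => i.succ.succ with hr
  have hfin : List.finRange (n + 2) = 0 :: 1 :: r := by
    simp [List.finRange_succ, hr, Function.comp_def]
  obtain ⟨L, hL, e⟩ := exists_foldl_lcommList_eq_sum y r [0, 1] (by simp)
  refine ⟨L, fun pr hpr => ?_, ?_⟩
  · obtain ⟨hlen, hperm⟩ := hL pr hpr
    have hperm' : (pr.1 ++ pr.2).Perm (List.finRange (n + 2)) := by
      rw [hfin]
      exact hperm
    have h := hperm'.length_eq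
    rw [List.length_append, List.length_finRange] at h
    have h2 : 2 ≤ pr.2.length := hlen
    exact ⟨by omega, h2, hperm'⟩
  · have hswap : r.map (y ∘ Equiv.swap (0 : Fin (n + 2)) 1) = r.map y := by
      refine List.map_congr_left fun i hi => ?_
      obtain ⟨j, -, rfl⟩ := List.mem_map.1 hi
      rw [Function.comp_apply, Equiv.swap_apply_of_ne_of_ne (Fin.succ_ne_zero _)]
      exact fun h => Fin.succ_ne_zero j (Fin.succ_injective _ h)
    change _ = listProd ((List.finRange (n + 2)).map
      (y ∘ Equiv.swap (0 : Fin (n + 2)) 1)) + _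
    rw [← e, hfin, List.map_cons, List.map_cons, List.map_cons, List.map_cons, hswap]
    simp only [listProd, List.foldl_cons, Function.comp_apply, Equiv.swap_apply_left,
      Equiv.swap_apply_right, ← foldl_mul_add, List.map_nil, List.map_cons, lcommList, lcomm]
    rw [add_sub_cancel]
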